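/- Let r ≥ 1, let e₁ denote the first standard basis vector of ℂʳ, and let f : (0,∞) → ℝ be C². Suppose ℓ > 0 and k ∈ ℤ satisfy f′(ℓ) = 4πk and f″(ℓ) ≠ 0. For ε > 0 define Φ_ε : ℂʳ → ℂʳ by Φ_ε(x) = exp(−i·f′(|x + ε·e₁|²/4)/2)·(x + ε·e₁). Then there exist ε₀ > 0 and an open interval I containing ℓ such that for every ε ∈ (0, ε₀): the set of fixed points x of Φ_ε with |x|²/4 ∈ I consists of exactly two points; each of them has the form (−ε/2 + i·y)·e₁ for some real y, with one of the two points having y > 0 and the other y < 0; and at each of these two fixed points, 1 is not an eigenvalue of the derivative of Φ_ε (regarded as a real-linear map on ℂʳ ≅ ℝ^{2r}). -/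

import Mathlib

open Real

lemma aux_exp (G : ℝ) (k : ℤ) :
    Complex.exp (-Complex.I * (G : ℂ) / 2)
      = ((Real.cos (G / 4 - π * k) : ℂ) - Complex.I * (Real.sin (G / 4 - π * k) : ℂ)) ^ 2 := by
  have h1 : ((Real.cos (G / 4 - π * k) : ℂ) - Complex.I * (Real.sin (G / 4 - π * k) : ℂ))
      = Complex.exp (-((G / 4 - π * k : ℝ) : ℂ) * Complex.I) := by
    rw [Complex.exp_mul_I, Complex.cos_neg, Complex.sin_neg]
    push_cast
    ring
  rw [h1, ← Complex.exp_nat_mul]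
  have h2 : ((2 : ℕ) : ℂ) * (-((G / 4 - π * k : ℝ) : ℂ) * Complex.I)
      = -Complex.I * (G : ℂ) / 2 + k * (2 * π * Complex.I) := by
    push_cast; ring
  rw [h2, Complex.exp_add, Complex.exp_int_mul_two_pi_mul_I, mul_one]

lemma aux_fwd (ε C S : ℝ) (hε : 0 < ε) (hCS : C ^ 2 + S ^ 2 = 1) (z : ℂ)
    (h : ((C : ℂ) - Complex.I * S) ^ 2 * (z + ε) = z) :
    ∃ t : ℝ, t * S = -ε / 2 ∧ z = -(ε : ℂ) / 2 + Complex.I * ((t * C : ℝ) : ℂ) := by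
  obtain ⟨X, y⟩ := z
  have hre := congrArg Complex.re h
  have him := congrArg Complex.im h
  simp [pow_two] at hre him
  have hS : S ≠ 0 := by
    rintro rfl
    have : C * C = 1 := by nlinarith
    simp [this] at hre
    exact hε.ne' hre
  have h1 : S * y + C * (X + ε) = 0 := by
    have : S * (S * y + C * (X + ε)) = 0 := by
      linear_combination (-1/2) * him + (1/2) * y * hCS
    exact (mul_eq_zero.1 this).resolve_left hS
  have h2 : X = -ε / 2 := by
    linear_combination (-1/2) * hre + C * h1 - (1/2) * (X + ε) * hCS
  subst h2
  refine ⟨C * y - S * (ε / 2), ?_, ?_⟩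
  · linear_combination C * h1 - (ε / 2) * hCS
  · apply Complex.ext
    · simp
    · simp
      linear_combination S * h1 - y * hCS

lemma aux_bwd (ε C S t : ℝ) (hCS : C ^ 2 + S ^ 2 = 1) (hS : t * S = -ε / 2) :
    ((C : ℂ) - Complex.I * S) ^ 2 * ((-(ε : ℂ) / 2 + Complex.I * ((t * C : ℝ) : ℂ)) + ε)
      = -(ε : ℂ) / 2 + Complex.I * ((t * C : ℝ) : ℂ) := by
  have hε : ε = -2 * t * S := by linarith
  subst hε
  apply Complex.ext
  · simp [pow_two]
    linear_combination (t * S) * hCS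
  · simp [pow_two]
    linear_combination (t * C) * hCS

/-- linear algebra of nondegeneracy -/
lemma aux_nd (ε C S t s d c : ℝ) (hε : 0 < ε) (hCS : C ^ 2 + S ^ 2 = 1)
    (hS : t * S = -ε / 2) (ht : t ^ 2 = 4 * s) (hK : C * d * s + 2 * S ≠ 0) (b : ℂ)
    (hc : c = ((starRingEnd ℂ) ((ε : ℂ) / 2 + Complex.I * ((t * C : ℝ) : ℂ)) * b).re)
    (h : ((C : ℂ) - Complex.I * S) ^ 2 *
      (b - Complex.I * ((d / 4 * c : ℝ) : ℂ) * ((ε : ℂ) / 2 + Complex.I * ((t * C : ℝ) : ℂ))) = b) :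
    b = 0 := by
  have hε' : ε = -2 * t * S := by linarith
  have ht0 : t ≠ 0 := by rintro rfl; simp at hε'; exact hε.ne' hε'
  have hS0 : S ≠ 0 := by rintro rfl; simp at hε'; exact hε.ne' hε'
  subst hε'
  obtain ⟨p, q⟩ := b
  have hre := congrArg Complex.re h
  have him := congrArg Complex.im h
  rw [Complex.mul_re, Complex.conj_re, Complex.conj_im] at hc
  simp [pow_two] at hre him hc
  have hq : 2 * S * q + d / 4 * c * t = 0 := by
    linear_combination C * hre - S * him
      - (C * p + S * q + d / 4 * c * t * (C ^ 2 + S ^ 2 + 1)) * hCS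
  have hp : -2 * S * p = 0 := by
    linear_combination C * him + S * hre - (C * q - S * p) * hCS
  have hp0 : p = 0 := by
    have := (mul_eq_zero.1 hp).resolve_left (by simpa using hS0)
    exact this
  subst hp0
  have hc0 : c * (C * d * s + 2 * S) = 0 := by
    linear_combination 2 * S * hc + t * C * hq - (d / 4 * c * C) * ht
  have hc1 := (mul_eq_zero.1 hc0).resolve_right hK
  subst hc1
  have hq0 : q = 0 := by
    have : S * q = 0 := by linarith
    exact (mul_eq_zero.1 this).resolve_left hS0
  subst hq0
  rfl

lemma aux_deriv {E : Type*} [NormedAddCommGroup E] [InnerProductSpace ℂ E]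
    (g : ℝ → ℝ) (hg : Differentiable ℝ g) (a : E) (Φ : E → E)
    (hΦ : ∀ x, Φ x = Complex.exp (-Complex.I * ((g (‖x + a‖ ^ 2 / 4) : ℝ) : ℂ) / 2) • (x + a))
    (x v : E) (hv : fderiv ℝ Φ x v = v) (hd : DifferentiableAt ℝ Φ x) :
    Complex.exp (-Complex.I * ((g (‖x + a‖ ^ 2 / 4) : ℝ) : ℂ) / 2) •
      (v - (Complex.I * ((deriv g (‖x + a‖ ^ 2 / 4) / 4 *
        (inner ℂ (x + a) v).re : ℝ) : ℂ)) • (x + a)) = v := by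
  have h1 : HasDerivAt (fun t : ℝ => x + t • v) v 0 := by
    simpa using ((hasDerivAt_id (0:ℝ)).smul_const v).const_add x
  have h2 : HasDerivAt (fun t : ℝ => Φ (x + t • v)) v 0 := by
    have h0 : HasFDerivAt Φ (fderiv ℝ Φ x) (x + (0:ℝ) • v) := by simpa using hd.hasFDerivAt
    have := h0.comp_hasDerivAt (0:ℝ) h1
    rwa [hv] at this
  have hn : ∀ t : ℝ, ‖x + t • v + a‖ ^ 2
      = ‖x + a‖ ^ 2 + t * (2 * (inner ℂ (x + a) v).re) + t ^ 2 * ‖v‖ ^ 2 := by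
    intro t
    have e : x + t • v + a = (x + a) + (t : ℂ) • v := by
      rw [Complex.coe_smul]; abel
    rw [e, @norm_add_sq ℂ, inner_smul_right, norm_smul, mul_pow]
    generalize x + a = w
    simp
    ring
  have h3 : HasDerivAt (fun t : ℝ => ‖x + t • v + a‖ ^ 2 / 4)
      ((inner ℂ (x + a) v).re / 2) 0 := by
    simp_rw [hn]
    have := ((((hasDerivAt_id (0:ℝ)).mul_const (2 * (inner ℂ (x + a) v).re)).const_add
      (‖x + a‖ ^ 2)).add (((hasDerivAt_id (0:ℝ)).pow 2).mul_const (‖v‖ ^ 2))).div_const 4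
    refine this.congr_deriv ?_
    generalize x + a = w
    simp
    try ring
  have h4 : HasDerivAt (fun t : ℝ => g (‖x + t • v + a‖ ^ 2 / 4))
      (deriv g (‖x + a‖ ^ 2 / 4) * ((inner ℂ (x + a) v).re / 2)) 0 := by
    have h0 : HasDerivAt g (deriv g (‖x + a‖ ^ 2 / 4)) (‖x + (0:ℝ) • v + a‖ ^ 2 / 4) := by
      simpa using (hg (‖x + a‖ ^ 2 / 4)).hasDerivAt
    exact h0.comp (0:ℝ) h3
  have h5 := (((h4.ofReal_comp).const_mul (-Complex.I)).div_const 2).cexp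
  have h6 := h5.smul (h1.add_const a)
  have h7 : (fun t : ℝ => Φ (x + t • v)) = fun t : ℝ =>
      Complex.exp (-Complex.I * ((g (‖x + t • v + a‖ ^ 2 / 4) : ℝ) : ℂ) / 2) • (x + t • v + a) := by
    funext t; rw [hΦ]
  rw [h7] at h2
  have h8 := h2.unique h6
  simp only [zero_smul, add_zero] at h8
  nth_rewrite 3 [h8]
  rw [smul_sub, sub_eq_add_neg, smul_smul, ← neg_smul]
  congr 2
  push_cast
  ring

theorem aux_loc (g : ℝ → ℝ) (hg : ContDiff ℝ 1 g) (ℓ : ℝ) (hℓ : 0 < ℓ) (k : ℤ)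
    (hres : g ℓ = 4 * π * k) (hnd : deriv g ℓ ≠ 0) :
    ∃ δ > (0:ℝ), ∃ a b : ℝ, a < ℓ ∧ ℓ < b ∧
      (∀ s ∈ Set.Ioo a b, 0 < s ∧ 0 < Real.cos (g s / 4 - π * k) ∧
        Real.cos (g s / 4 - π * k) * deriv g s * s + 2 * Real.sin (g s / 4 - π * k) ≠ 0) ∧
      Set.InjOn (fun s => √s * Real.sin (g s / 4 - π * k)) (Set.Ioo a b) ∧
      ∀ c : ℝ, |c| < δ → ∃ s ∈ Set.Ioo a b, √s * Real.sin (g s / 4 - π * k) = c := by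
  have hψ : g ℓ / 4 - π * k = 0 := by rw [hres]; ring
  have hgd : Differentiable ℝ g := hg.differentiable (by simp)
  have hgc : Continuous g := hgd.continuous
  have hgc' : Continuous (deriv g) := hg.continuous_deriv (by simp)
  have hst : HasStrictDerivAt g (deriv g ℓ) ℓ := hg.hasStrictDerivAt (by simp)
  have hH : HasStrictDerivAt (fun s => √s * Real.sin (g s / 4 - π * k))
      (√ℓ * (deriv g ℓ / 4)) ℓ := by
    have h1 := Real.hasStrictDerivAt_sqrt hℓ.ne'
    have h2 : HasStrictDerivAt (fun s => Real.sin (g s / 4 - π * k))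
        (Real.cos (g ℓ / 4 - π * k) * (deriv g ℓ / 4)) ℓ := by
      have h0 : HasStrictDerivAt (fun s => g s / 4 - π * k) (deriv g ℓ / 4) ℓ :=
        (hst.div_const 4).sub_const (π * k)
      exact (Real.hasStrictDerivAt_sin (g ℓ / 4 - π * k)).comp ℓ h0
    have h3 := h1.mul h2
    refine h3.congr_deriv ?_
    simp [hψ]
  have hne : √ℓ * (deriv g ℓ / 4) ≠ 0 := by
    have := (Real.sqrt_pos.2 hℓ).ne'
    positivity
  have hH0 : √ℓ * Real.sin (g ℓ / 4 - π * k) = 0 := by simp [hψ]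
  have hmap := hH.map_nhds_eq hne
  have e1 : ∀ᶠ s in nhds ℓ, 0 < s := lt_mem_nhds hℓ
  have e2 : ∀ᶠ s in nhds ℓ, 0 < Real.cos (g s / 4 - π * k) := by
    have : Continuous fun s => Real.cos (g s / 4 - π * k) := by fun_prop
    apply this.continuousAt.eventually (lt_mem_nhds _)
    simp [hψ]
  have e3 : ∀ᶠ s in nhds ℓ,
      Real.cos (g s / 4 - π * k) * deriv g s * s + 2 * Real.sin (g s / 4 - π * k) ≠ 0 := by
    have : Continuous fun s =>
      Real.cos (g s / 4 - π * k) * deriv g s * s + 2 * Real.sin (g s / 4 - π * k) := by fun_prop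
    apply this.continuousAt.eventually_ne
    simp [hψ, hnd, hℓ.ne']
  have e4 := hH.hasStrictFDerivAt_equiv hne
  have e5 := e4.mem_toOpenPartialHomeomorph_source
  have e6 := (e4.toOpenPartialHomeomorph _).open_source.mem_nhds e5
  have e7 := (e4.toOpenPartialHomeomorph _).injOn
  obtain ⟨a, b, ⟨ha, hb⟩, hab⟩ := mem_nhds_iff_exists_Ioo_subset.1
    (Filter.inter_mem e6 (e1.and (e2.and e3)))
  have himg := Filter.image_mem_map (m := fun s => √s * Real.sin (g s / 4 - π * k))
    (Ioo_mem_nhds ha hb)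
  rw [hmap, hH0] at himg
  obtain ⟨δ, hδ, hball⟩ := Metric.mem_nhds_iff.1 himg
  refine ⟨δ, hδ, a, b, ha, hb, fun s hs => (hab hs).2, fun s hs s' hs' h => ?_, fun c hc => ?_⟩
  · exact e7 (hab hs).1 (hab hs').1 h
  · exact hball (by simpa using hc)

/-- Fiberwise content of Proposition 3.4 of the paper: for the perturbed fiberwise
time-one map `Φ_ε(x) = e^{−i f′(|x+εe₁|²/4)/2}(x + ε e₁)`, near a transversally
nondegenerate fixed-point level `ℓ` (`f′(ℓ) = 4πk`, `f″(ℓ) ≠ 0`) and for small `ε > 0`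
there are exactly two fixed points with `|x|²/4` near `ℓ`; they have the form
`(−ε/2 + i y) e₁` with `y > 0` resp. `y < 0`, and both are nondegenerate: `1` is not an
eigenvalue of the real derivative of `Φ_ε` there. -/
theorem stmt9 (r : ℕ) (hr : 0 < r)
    (e₁ : EuclideanSpace ℂ (Fin r))
    (he₁ : e₁ = EuclideanSpace.single (⟨0, hr⟩ : Fin r) (1 : ℂ))
    (f : ℝ → ℝ) (hf : ContDiff ℝ 2 f)
    (ℓ : ℝ) (hℓ : 0 < ℓ) (k : ℤ)
    (hres : deriv f ℓ = 4 * π * k) (hnd : deriv (deriv f) ℓ ≠ 0)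
    (Φ : ℝ → EuclideanSpace ℂ (Fin r) → EuclideanSpace ℂ (Fin r))
    (hΦ : ∀ (ε : ℝ) (x : EuclideanSpace ℂ (Fin r)),
      Φ ε x = Complex.exp (-Complex.I *
          (Complex.ofReal (deriv f (‖x + (ε : ℂ) • e₁‖ ^ 2 / 4))) / 2)
        • (x + (ε : ℂ) • e₁)) :
    ∃ ε₀ > (0:ℝ), ∃ a b : ℝ, a < ℓ ∧ ℓ < b ∧
      ∀ ε : ℝ, 0 < ε → ε < ε₀ →
        ∃ yp yn : ℝ, 0 < yp ∧ yn < 0 ∧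
          ((-(ε:ℂ) / 2 + Complex.I * (yp : ℂ)) • e₁
              ≠ (-(ε:ℂ) / 2 + Complex.I * (yn : ℂ)) • e₁) ∧
          {x : EuclideanSpace ℂ (Fin r) | Φ ε x = x ∧ ‖x‖ ^ 2 / 4 ∈ Set.Ioo a b}
            = {(-(ε:ℂ) / 2 + Complex.I * (yp : ℂ)) • e₁,
               (-(ε:ℂ) / 2 + Complex.I * (yn : ℂ)) • e₁} ∧
          ∀ x : EuclideanSpace ℂ (Fin r),
            Φ ε x = x → ‖x‖ ^ 2 / 4 ∈ Set.Ioo a b →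
              ∀ v : EuclideanSpace ℂ (Fin r), fderiv ℝ (Φ ε) x v = v → v = 0 := by
  have hg : ContDiff ℝ 1 (deriv f) := by
    have h : ContDiff ℝ (1 + 1) f := by simpa [one_add_one_eq_two] using hf
    exact (contDiff_succ_iff_deriv.1 h).2.2
  generalize deriv f = g at *
  have hgd : Differentiable ℝ g := hg.differentiable (by simp)
  have he : ‖e₁‖ = 1 := by simp [he₁]
  have he0 : e₁ ≠ 0 := by
    rintro h
    simp [h] at he
  clear he₁
  have hinj : ∀ z w : ℂ, z • e₁ = w • e₁ → z = w := fun z w h => smul_left_injective ℂ he0 h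
  obtain ⟨δ, hδ, a, b, ha, hb, hI, hHinj, hsurj⟩ := aux_loc g hg ℓ hℓ k hres hnd
  have hCS : ∀ s, Real.cos (g s / 4 - π * k) ^ 2 + Real.sin (g s / 4 - π * k) ^ 2 = 1 :=
    fun s => Real.cos_sq_add_sin_sq _
  have hnorm : ∀ ε x, Φ ε x = x → ‖x + (ε : ℂ) • e₁‖ = ‖x‖ := by
    intro ε x h
    have h1 : ‖Complex.exp (-Complex.I * ((g (‖x + (ε : ℂ) • e₁‖ ^ 2 / 4) : ℝ) : ℂ) / 2)‖ = 1 := by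
      rw [Complex.norm_exp]
      simp
    rw [hΦ] at h
    have h2 := congrArg norm h
    rwa [norm_smul, h1, one_mul] at h2
  have hzn : ∀ (σ t C S ε s : ℝ), C ^ 2 + S ^ 2 = 1 → t * S = -ε / 2 → t ^ 2 = 4 * s →
      σ ^ 2 = 1 →
      ‖(((σ * (ε / 2) : ℝ) : ℂ) + Complex.I * ((t * C : ℝ) : ℂ)) • e₁‖ ^ 2 / 4 = s := by
    intro σ t C S ε s h1 h2 h3 h4
    rw [norm_smul, he, mul_one, ← Complex.normSq_eq_norm_sq, Complex.normSq_apply]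
    simp
    have h5 : ε = -2 * t * S := by linarith
    subst h5
    linear_combination (t ^ 2 * S ^ 2 / 4) * h4 + t ^ 2 / 4 * h1 + h3 / 4
  have hadd : ∀ (ε : ℝ) (y : ℂ), (-(ε : ℂ) / 2 + y) • e₁ + (ε : ℂ) • e₁
      = ((ε : ℂ) / 2 + y) • e₁ := by
    intro ε y
    rw [← add_smul]; congr 1; ring
  have hfwd : ∀ (ε : ℝ) x, 0 < ε → Φ ε x = x → ∀ s, s = ‖x‖ ^ 2 / 4 → 
      ∃ t : ℝ, t ^ 2 = 4 * s ∧ t * Real.sin (g s / 4 - π * k) = -ε / 2 ∧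
        x = (-(ε : ℂ) / 2 + Complex.I * ((t * Real.cos (g s / 4 - π * k) : ℝ) : ℂ)) • e₁ := by
    intro ε x hε h s hs
    have hn := hnorm ε x h
    rw [hΦ, hn, ← hs, aux_exp _ k] at h
    have hA : ((Real.cos (g s / 4 - π * k) : ℂ) - Complex.I * (Real.sin (g s / 4 - π * k) : ℂ)) ^ 2
        ≠ 1 := by
      intro hA
      rw [hA, one_smul, add_eq_left, smul_eq_zero] at h
      rcases h with h | h
      · exact hε.ne' (by exact_mod_cast h)
      · exact he0 h
    generalize hAd : ((Real.cos (g s / 4 - π * k) : ℂ)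
      - Complex.I * (Real.sin (g s / 4 - π * k) : ℂ)) ^ 2 = A at *
    have hA' : 1 - A ≠ 0 := sub_ne_zero.2 (Ne.symm hA)
    have hx : ∃ z : ℂ, x = z • e₁ := by
      refine ⟨(1 - A)⁻¹ * (A * ε), ?_⟩
      have h1 : (1 - A) • x = (A * ε) • e₁ := by
        rw [sub_smul, one_smul, mul_smul, sub_eq_iff_eq_add, ← smul_add, add_comm _ x]
        exact h.symm
      rw [mul_smul, ← h1, smul_smul, inv_mul_cancel₀ hA', one_smul]
    obtain ⟨z, hz⟩ := hx
    have hz2 : A * (z + ε) = z := by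
      apply hinj
      rw [mul_smul, add_smul, ← hz]
      exact h
    rw [← hAd] at hz2
    obtain ⟨t, ht1, ht2⟩ := aux_fwd ε _ _ hε (hCS s) z hz2
    refine ⟨t, ?_, ht1, by rw [hz, ht2]⟩
    have := hzn (-1) t _ _ ε (t ^ 2 / 4) (hCS s) ht1 (by ring) (by norm_num)
    have e : (((-1 * (ε / 2) : ℝ) : ℂ) + Complex.I * ((t * Real.cos (g s / 4 - π * k) : ℝ) : ℂ))
        = z := by rw [ht2]; push_cast; ring
    rw [e, ← hz, ← hs] at this
    linarith
  have hbwd : ∀ (ε s t : ℝ), t ^ 2 = 4 * s → t * Real.sin (g s / 4 - π * k) = -ε / 2 →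
      ∀ x, x = (-(ε : ℂ) / 2 + Complex.I * ((t * Real.cos (g s / 4 - π * k) : ℝ) : ℂ)) • e₁ →
      ‖x‖ ^ 2 / 4 = s ∧ ‖x + (ε : ℂ) • e₁‖ ^ 2 / 4 = s ∧ Φ ε x = x := by
    intro ε s t ht1 ht2 x hx
    have n1 : ‖x‖ ^ 2 / 4 = s := by
      have := hzn (-1) t _ _ ε s (hCS s) ht2 ht1 (by norm_num)
      rw [← this, hx]; congr 5; push_cast; ring
    have n2 : ‖x + (ε : ℂ) • e₁‖ ^ 2 / 4 = s := by
      have := hzn 1 t _ _ ε s (hCS s) ht2 ht1 (by norm_num)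
      rw [hx, hadd]
      refine Eq.trans ?_ this
      congr 5; push_cast; ring
    refine ⟨n1, n2, ?_⟩
    rw [hΦ, n2, aux_exp _ k, hx, ← add_smul, smul_smul, aux_bwd ε _ _ t (hCS s) ht2]
  refine ⟨4 * δ, by positivity, a, b, ha, hb, fun ε hε hε0 => ?_⟩
  obtain ⟨sp, hsp, hHp⟩ := hsurj (-ε / 4) (by rw [abs_lt]; constructor <;> linarith)
  obtain ⟨sn, hsn, hHn⟩ := hsurj (ε / 4) (by rw [abs_lt]; constructor <;> linarith)
  obtain ⟨hp1, hp2, -⟩ := hI sp hsp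
  obtain ⟨hn1, hn2, -⟩ := hI sn hsn
  have hyp : 0 < 2 * √sp * Real.cos (g sp / 4 - π * k) := by positivity
  have hyn : -(2 * √sn) * Real.cos (g sn / 4 - π * k) < 0 := by
    have : 0 < 2 * √sn * Real.cos (g sn / 4 - π * k) := by positivity
    linarith
  refine ⟨2 * √sp * Real.cos (g sp / 4 - π * k), -(2 * √sn) * Real.cos (g sn / 4 - π * k),
    hyp, hyn, ?_, ?_, ?_⟩
  · intro h
    have h1 := congrArg Complex.im (hinj _ _ h)
    simp only [Complex.add_im, Complex.I_mul_im, Complex.ofReal_re] at h1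
    linarith
  · ext x
    simp only [Set.mem_ofPred_eq, Set.mem_insert_iff, Set.mem_singleton_iff]
    constructor
    · rintro ⟨hx, hxI⟩
      obtain ⟨t, ht1, ht2, ht3⟩ := hfwd ε x hε hx _ rfl
      obtain ⟨hs0, -, -⟩ := hI _ hxI
      generalize ‖x‖ ^ 2 / 4 = s at *
      have hsq : √s ^ 2 = s := Real.sq_sqrt hs0.le
      have hcase : (t - 2 * √s) * (t + 2 * √s) = 0 := by
        linear_combination ht1 - 4 * hsq
      rcases mul_eq_zero.1 hcase with h | h
      · left
        have ht : t = 2 * √s := by linarith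
        have : s = sp := hHinj hxI hsp (by
          show √s * Real.sin (g s / 4 - π * k) = √sp * Real.sin (g sp / 4 - π * k)
          rw [hHp]; rw [ht] at ht2; linarith)
        rw [ht3, ht, this]
      · right
        have ht : t = -(2 * √s) := by linarith
        have : s = sn := hHinj hxI hsn (by
          show √s * Real.sin (g s / 4 - π * k) = √sn * Real.sin (g sn / 4 - π * k)
          rw [hHn]; rw [ht] at ht2; linarith)
        rw [ht3, ht, this]
    · rintro (h | h)
      · obtain ⟨h1, -, h3⟩ := hbwd ε sp (2 * √sp)
          (by rw [mul_pow, Real.sq_sqrt hp1.le]; norm_num) (by linarith) x h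
        exact ⟨h3, by rwa [h1]⟩
      · obtain ⟨h1, -, h3⟩ := hbwd ε sn (-(2 * √sn))
          (by rw [neg_sq, mul_pow, Real.sq_sqrt hn1.le]; norm_num) (by linarith) x h
        exact ⟨h3, by rwa [h1]⟩
  · intro x hx hxI v hv
    by_cases hd : DifferentiableAt ℝ (Φ ε) x
    swap
    · rw [fderiv_zero_of_not_differentiableAt hd] at hv
      simpa using hv.symm
    have key := aux_deriv g hgd ((ε : ℂ) • e₁) (Φ ε) (hΦ ε) x v hv hd
    obtain ⟨t, ht1, ht2, ht3⟩ := hfwd ε x hε hx _ rfl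
    obtain ⟨hs0, -, hK⟩ := hI _ hxI
    rw [hnorm ε x hx] at key
    generalize ‖x‖ ^ 2 / 4 = s at *
    rw [aux_exp _ k] at key
    have hxe : x + (ε : ℂ) • e₁ = ((ε : ℂ) / 2
        + Complex.I * ((t * Real.cos (g s / 4 - π * k) : ℝ) : ℂ)) • e₁ := by
      rw [← hadd, ← ht3]
    rw [hxe] at key
    have hA : ((Real.cos (g s / 4 - π * k) : ℂ) - Complex.I * (Real.sin (g s / 4 - π * k) : ℂ)) ^ 2
        ≠ 1 := by
      intro hA
      have h1 := aux_bwd ε _ _ t (hCS s) ht2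
      rw [hA, one_mul, add_eq_left] at h1
      exact hε.ne' (by exact_mod_cast h1)
    have hb : ∃ β : ℂ, v = β • e₁ := by
      generalize ((Real.cos (g s / 4 - π * k) : ℂ)
        - Complex.I * (Real.sin (g s / 4 - π * k) : ℂ)) ^ 2 = A at *
      rw [smul_sub, smul_smul, smul_smul] at key
      have hA' : A - 1 ≠ 0 := sub_ne_zero.2 hA
      have h1 : (A - 1) • v = A • v - v := by rw [sub_smul, one_smul]
      rw [sub_eq_iff_eq_add, ← sub_eq_iff_eq_add', ← h1] at key
      have h2 := congrArg (fun w => (A - 1)⁻¹ • w) key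
      simp only [smul_smul, inv_mul_cancel₀ hA', one_smul] at h2
      exact ⟨_, h2⟩
    obtain ⟨β, hβ⟩ := hb
    rw [hβ, inner_smul_left, inner_smul_right, inner_self_eq_norm_sq_to_K, he, smul_smul,
      ← sub_smul, smul_smul] at key
    have key2 := hinj _ _ key
    have := aux_nd ε _ _ t s (deriv g s) _ hε (hCS s) ht2 ht1 hK β rfl (by simpa using key2)
    rw [hβ, this, zero_smul]
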